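/- Let S, T be finite nonempty index types, let ψ ∈ ℂ^{S×T} be a unit vector, and let R = Tr_T(ψψᴴ) be its reduced density matrix on the first factor, i.e. the S × S matrix with entries R_{s,s'} = Σ_{t} ψ(s,t)·conj(ψ(s',t)). Let p be a real number such that R − p•1 is positive semidefinite (p is at most the smallest eigenvalue of R), let Q be an orthogonal projection on ℂ^S with Q ≠ 1, and let σ be a density matrix on ℂ^{S×T} satisfying (Q ⊗ 1)σ(Q ⊗ 1) = σ. Then the fidelity of σ with the target state ψ obeys ⟨ψ, σψ⟩ ≤ 1 − p. That is, any state invariant under a nontrivial local projection has overlap with ψ at most 1 minus the smallest eigenvalue of the reduced density matrix of ψ. -/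

import Mathlib

open Matrix ComplexOrder

noncomputable section

/-- Outer product `v wᴴ` of two vectors. -/
def outer {ι κ : Type*} (v : ι → ℂ) (w : κ → ℂ) : Matrix ι κ ℂ :=
  Matrix.of fun i j => v i * (starRingEnd ℂ) (w j)

/-- Partial trace over the second tensor factor. -/
def ptraceSnd {S T : Type*} [Fintype T] (M : Matrix (S × T) (S × T) ℂ) :
    Matrix S S ℂ :=
  Matrix.of fun s s' => ∑ t, M (s, t) (s', t)

/-- `Q ⊗ 1`, acting as `Q` on the first factor of `S × T`. -/
def kronIdRight {S T : Type*} [DecidableEq T] (Q : Matrix S S ℂ) :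
    Matrix (S × T) (S × T) ℂ :=
  Matrix.of fun p q => Q p.1 q.1 * (if p.2 = q.2 then 1 else 0)

open scoped MatrixOrder Matrix.Norms.L2Operator in
/-- The quadratic form of a positive semidefinite matrix is bounded by its trace. -/
theorem Matrix.PosSemidef.dotProduct_mulVec_le_trace_mul {ι : Type*} [Fintype ι]
    {A : Matrix ι ι ℂ} (hA : A.PosSemidef) (v : ι → ℂ) :
    star v ⬝ᵥ A *ᵥ v ≤ A.trace * (star v ⬝ᵥ v) := by
  classical
  obtain ⟨B, rfl⟩ : ∃ B : Matrix ι ι ℂ, A = Bᴴ * B :=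
    CStarAlgebra.nonneg_iff_eq_star_mul_self.mp hA.nonneg
  have hv : star v ⬝ᵥ v = ((∑ j, ‖v j‖ ^ 2 : ℝ) : ℂ) := by
    simp [dotProduct, Complex.conj_mul']
  have hq : star v ⬝ᵥ (Bᴴ * B) *ᵥ v = ((∑ i, ‖∑ j, B i j * v j‖ ^ 2 : ℝ) : ℂ) := by
    rw [← mulVec_mulVec, dotProduct_mulVec, ← star_mulVec]
    simp only [dotProduct, Pi.star_apply, Complex.star_def, Complex.conj_mul']
    push_cast
    rfl
  have ht : (Bᴴ * B).trace = ((∑ i, ∑ j, ‖B i j‖ ^ 2 : ℝ) : ℂ) := by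
    rw [Finset.sum_comm]
    simp [trace, mul_apply, Complex.conj_mul']
  rw [hv, hq, ht, ← Complex.ofReal_mul, Complex.real_le_real, Finset.sum_mul]
  refine Finset.sum_le_sum fun i _ => ?_
  calc ‖∑ j, B i j * v j‖ ^ 2 ≤ (∑ j, ‖B i j‖ * ‖v j‖) ^ 2 := by
        gcongr
        simpa only [norm_mul] using norm_sum_le Finset.univ fun j => B i j * v j
    _ ≤ _ := Finset.sum_mul_sq_le_sq_mul_sq _ _ _

/-- A nonzero orthogonal projection has trace at least one. -/
theorem one_le_trace_of_isStarProjection {ι : Type*} [Fintype ι]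
    {P : Matrix ι ι ℂ} (hP : IsStarProjection P) (hne : P ≠ 0) : 1 ≤ P.trace := by
  have hH : Pᴴ = P := hP.isSelfAdjoint
  have hI : P * P = P := hP.isIdempotentElem
  have hpsd : P.PosSemidef := by
    simpa only [hH, hI] using posSemidef_conjTranspose_mul_self P
  obtain ⟨j, hj⟩ : ∃ j, P.col j ≠ 0 := by
    by_contra! h
    exact hne (by ext i j; exact congrFun (h j) i)
  have hPv : P *ᵥ P.col j = P.col j := by
    ext i
    exact congrFun (congrFun hI i) j
  have hpos : 0 < star (P.col j) ⬝ᵥ P.col j := dotProduct_star_self_pos_iff.mpr hj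
  have h := hpsd.dotProduct_mulVec_le_trace_mul (P.col j)
  rw [hPv] at h
  exact le_of_mul_le_mul_right (by simpa using h) hpos

theorem trace_mul_nonneg_of_isStarProjection {ι : Type*} [Fintype ι]
    {P A : Matrix ι ι ℂ} (hP : IsStarProjection P) (hA : A.PosSemidef) :
    0 ≤ (P * A).trace := by
  have hH : Pᴴ = P := hP.isSelfAdjoint
  have hI : P * P = P := hP.isIdempotentElem
  have h := (hA.conjTranspose_mul_mul_same P).trace_nonneg
  rwa [hH, trace_mul_comm, ← mul_assoc, hI] at h

theorem posSemidef_ptraceSnd_outer {S T : Type*} [Finite S] [Fintype T] (ψ : S × T → ℂ) :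
    (ptraceSnd (outer ψ ψ)).PosSemidef := by
  have := Fintype.ofFinite S
  exact posSemidef_self_mul_conjTranspose (Matrix.of fun s t => ψ (s, t))

theorem kronIdRight_conjTranspose {S T : Type*} [DecidableEq T] (Q : Matrix S S ℂ) :
    (kronIdRight Q : Matrix (S × T) (S × T) ℂ)ᴴ = kronIdRight Qᴴ := by
  ext a b
  by_cases h : a.2 = b.2 <;> simp [kronIdRight, h, Ne.symm]

theorem kronIdRight_mul {S T : Type*} [Fintype S] [Fintype T] [DecidableEq T]
    (A B : Matrix S S ℂ) :
    (kronIdRight A * kronIdRight B : Matrix (S × T) (S × T) ℂ) = kronIdRight (A * B) := by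
  ext a b
  simp [kronIdRight, mul_apply, Fintype.sum_prod_type]

theorem dotProduct_kronIdRight_mulVec {S T : Type*} [Fintype S] [Fintype T] [DecidableEq T]
    (Q : Matrix S S ℂ) (ψ : S × T → ℂ) :
    star ψ ⬝ᵥ kronIdRight Q *ᵥ ψ = (Q * ptraceSnd (outer ψ ψ)).trace := by
  simp only [dotProduct, mulVec, trace, diag, mul_apply, kronIdRight, ptraceSnd, outer, of_apply,
    Fintype.sum_prod_type, Finset.mul_sum, mul_ite, ite_mul, mul_one, mul_zero, zero_mul,
    Finset.sum_ite_eq, Finset.mem_univ, if_true, Pi.star_apply, Complex.star_def]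
  refine Finset.sum_congr rfl fun s _ => ?_
  rw [Finset.sum_comm]
  refine Finset.sum_congr rfl fun s' _ => Finset.sum_congr rfl fun t _ => ?_
  ring

theorem stmt15 {S T : Type*} [Fintype S] [Fintype T] [DecidableEq S] [DecidableEq T]
    [Nonempty S] [Nonempty T]
    (ψ : S × T → ℂ) (hψ : ∑ p, (starRingEnd ℂ) (ψ p) * ψ p = 1)
    (R : Matrix S S ℂ) (hR : R = ptraceSnd (outer ψ ψ))
    (p : ℝ) (hpR : (R - (p : ℂ) • 1).PosSemidef)
    (Q : Matrix S S ℂ) (hQ : Qᴴ = Q ∧ Q * Q = Q) (hQne : Q ≠ 1)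
    (σ : Matrix (S × T) (S × T) ℂ) (hσ : σ.PosSemidef) (hσtr : σ.trace = 1)
    (hinv : kronIdRight Q * σ * kronIdRight Q = σ) :
    star ψ ⬝ᵥ σ.mulVec ψ ≤ ((1 - p : ℝ) : ℂ) := by
  obtain ⟨hQH, hQQ⟩ := hQ
  have hP : IsStarProjection (1 - Q) :=
    IsStarProjection.one_sub ⟨hQQ, hQH⟩
  have hRpsd : R.PosSemidef := hR ▸ posSemidef_ptraceSnd_outer ψ
  have hRtr : R.trace = 1 := by
    rw [hR, ← hψ, Fintype.sum_prod_type]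
    simp [trace, ptraceSnd, outer, mul_comm]
  have hPR : (p : ℂ) ≤ ((1 - Q) * R).trace := by
    rcases le_total p 0 with hp | hp
    · exact (Complex.real_le_real.mpr hp).trans (trace_mul_nonneg_of_isStarProjection hP hRpsd)
    · have h := trace_mul_nonneg_of_isStarProjection hP hpR
      rw [mul_sub, trace_sub, mul_smul_comm, mul_one, trace_smul, smul_eq_mul, sub_nonneg] at h
      have h1 := one_le_trace_of_isStarProjection hP (sub_ne_zero.mpr hQne.symm)
      exact (le_mul_of_one_le_right (Complex.zero_le_real.mpr hp) h1).trans h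
  set K : Matrix (S × T) (S × T) ℂ := kronIdRight Q with hK
  have hKH : Kᴴ = K := by rw [hK, kronIdRight_conjTranspose, hQH]
  have hstar : star (K *ᵥ ψ) = star ψ ᵥ* K := by rw [star_mulVec, hKH]
  calc star ψ ⬝ᵥ σ *ᵥ ψ = star (K *ᵥ ψ) ⬝ᵥ σ *ᵥ (K *ᵥ ψ) := by
        rw [hstar, ← dotProduct_mulVec, mulVec_mulVec, mulVec_mulVec, hinv]
    _ ≤ star (K *ᵥ ψ) ⬝ᵥ K *ᵥ ψ := by
        simpa [hσtr] using hσ.dotProduct_mulVec_le_trace_mul (K *ᵥ ψ)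
    _ = (Q * R).trace := by
        rw [hstar, ← dotProduct_mulVec, mulVec_mulVec, hK, kronIdRight_mul, hQQ,
          dotProduct_kronIdRight_mulVec, hR]
    _ = 1 - ((1 - Q) * R).trace := by
        rw [sub_mul, one_mul, trace_sub, hRtr, sub_sub_cancel]
    _ ≤ ((1 - p : ℝ) : ℂ) := by
        push_cast
        exact sub_le_sub_left hPR 1
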